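/- arXiv:2511.00748 — 6 statements merged into one kernel-verified Lean document; each statement's English description precedes it below -/
import Mathlib

section
/- Sibling child equivalence (Lemma 3.1): Let (s1, s2, X, Y) and (s1', s2', X, Y) be association configurations (with the same separator attribute X and the same label Y) such that cov(s1) = cov(s1'), cov(s2) = cov(s2'), and cov(s1) ≠ 0 and cov(s2) ≠ 0. If (s1, s2, X, Y) is a Simpson's paradox, then (s1', s2', X, Y) is also a Simpson's paradox. -/
/-- The coverage of a population `s` w.r.t. base table `T`: the multiset of records of `T`
matching `s` (wildcard `none` matches anything). -/
def cov {n : ℕ} {D : Fin n → Type} [∀ i, DecidableEq (D i)] {R : Type}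
    (a : R → (i : Fin n) → D i) (T : Multiset R)
    (s : (i : Fin n) → Option (D i)) : Multiset R :=
  T.filter (fun t => ∀ i, s i = none ∨ s i = some (a t i))

/-- The frequency statistic `P(Y | s)` (meaningful when `cov a T s ≠ 0`). -/
def freq {n : ℕ} {D : Fin n → Type} [∀ i, DecidableEq (D i)] {R : Type}
    (a : R → (i : Fin n) → D i) (T : Multiset R) (Y : R → Bool)
    (s : (i : Fin n) → Option (D i)) : ℚ :=
  (((cov a T s).filter (fun t => Y t = true)).card : ℚ) / ((cov a T s).card : ℚ)

/-- `s1` and `s2` are sibling populations with differential attribute `j`. -/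
def Siblings {n : ℕ} {D : Fin n → Type}
    (s1 s2 : (i : Fin n) → Option (D i)) (j : Fin n) : Prop :=
  (∃ u1 u2 : D j, u1 ≠ u2 ∧ s1 j = some u1 ∧ s2 j = some u2) ∧
  ∀ i, i ≠ j → s1 i = s2 i

/-- The association configuration `(s1, s2, X, Y)` (siblings with differential attribute `j`,
separator `X`) is a Simpson's paradox. -/
def IsSimpson {n : ℕ} {D : Fin n → Type} [∀ i, DecidableEq (D i)] {R : Type}
    (a : R → (i : Fin n) → D i) (T : Multiset R)
    (s1 s2 : (i : Fin n) → Option (D i)) (j X : Fin n) (Y : R → Bool) : Prop :=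
  Siblings s1 s2 j ∧ X ≠ j ∧ s1 X = none ∧
  cov a T s1 ≠ 0 ∧ cov a T s2 ≠ 0 ∧
  freq a T Y s2 ≤ freq a T Y s1 ∧
  (∀ v : D X, cov a T (Function.update s1 X (some v)) ≠ 0 →
    cov a T (Function.update s2 X (some v)) ≠ 0 →
    freq a T Y (Function.update s1 X (some v)) ≤ freq a T Y (Function.update s2 X (some v))) ∧
  (freq a T Y s2 < freq a T Y s1 ∨
    ∀ v : D X, cov a T (Function.update s1 X (some v)) ≠ 0 →
      cov a T (Function.update s2 X (some v)) ≠ 0 →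
      freq a T Y (Function.update s1 X (some v)) < freq a T Y (Function.update s2 X (some v)))

theorem cov_update_aux {n : ℕ} {D : Fin n → Type} [∀ i, DecidableEq (D i)] {R : Type}
    (a : R → (i : Fin n) → D i) (T : Multiset R)
    (s : (i : Fin n) → Option (D i)) (X : Fin n) (hX : s X = none) (v : D X) :
    cov a T (Function.update s X (some v)) = (cov a T s).filter (fun t => a t X = v) := by
  unfold cov
  rw [Multiset.filter_filter]
  refine Multiset.filter_congr fun t _ => ⟨fun h => ⟨?_, fun i => ?_⟩, fun h i => ?_⟩
  · have := h X
    simp at this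
    exact this.symm
  · by_cases hi : i = X
    · subst hi
      exact Or.inl hX
    · have := h i
      rwa [Function.update_of_ne hi] at this
  · by_cases hi : i = X
    · subst hi
      simp [h.1]
    · rw [Function.update_of_ne hi]
      exact h.2 i

/-- **Sibling child equivalence (Lemma 3.1).** If `(s1, s2, X, Y)` and `(s1', s2', X, Y)` are
association configurations with the same separator `X` and label `Y`, with
`cov s1 = cov s1'` and `cov s2 = cov s2'` (nonempty), and `(s1, s2, X, Y)` is a Simpson's
paradox, then so is `(s1', s2', X, Y)`. -/
theorem sibling_child_equivalence
    {n : ℕ} {D : Fin n → Type} [∀ i, Fintype (D i)] [∀ i, Nonempty (D i)]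
    [∀ i, DecidableEq (D i)] {R : Type}
    (a : R → (i : Fin n) → D i) (T : Multiset R)
    (s1 s2 s1' s2' : (i : Fin n) → Option (D i)) (j j' X : Fin n) (Y : R → Bool)
    (hsib' : Siblings s1' s2' j') (hXj' : X ≠ j') (hX' : s1' X = none)
    (h1 : cov a T s1 = cov a T s1') (h2 : cov a T s2 = cov a T s2')
    (h1ne : cov a T s1 ≠ 0) (h2ne : cov a T s2 ≠ 0)
    (hp : IsSimpson a T s1 s2 j X Y) :
    IsSimpson a T s1' s2' j' X Y := by
  obtain ⟨hsib, hXj, hX, -, -, c1, c2, c3⟩ := hp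
  have hX2 : s2 X = none := by rw [← hsib.2 X hXj]; exact hX
  have hX2' : s2' X = none := by rw [← hsib'.2 X hXj']; exact hX'
  have e1 : ∀ v, cov a T (Function.update s1 X (some v))
      = cov a T (Function.update s1' X (some v)) := fun v => by
    rw [cov_update_aux a T s1 X hX, cov_update_aux a T s1' X hX', h1]
  have e2 : ∀ v, cov a T (Function.update s2 X (some v))
      = cov a T (Function.update s2' X (some v)) := fun v => by
    rw [cov_update_aux a T s2 X hX2, cov_update_aux a T s2' X hX2', h2]
  simp only [freq, e1, e2, h1, h2] at c1 c2 c3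
  rw [h1] at h1ne
  rw [h2] at h2ne
  exact ⟨hsib', hXj', hX', h1ne, h2ne, c1, c2, c3⟩
end

section
/- Extension by separator and statistic equivalence (Proposition 4.4, core case; also the key step of the product-space Lemma 3.8): Let p = (s1, s2, X, Y) be a Simpson's paradox with differential attribute j, and let p' = (s1', s2', X', Y') be a Simpson's paradox that is fully redundant to p. Suppose X' ≠ j and s1 X' = none = s2 X'. Then (s1, s2, X', Y') is a Simpson's paradox, and it is fully redundant to p. -/
/-- Full redundancy of the association configurations `(s1, s2, X, Y)` and
`(s1', s2', X', Y')`: the sibling coverages coincide, the aggregate frequency statistics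
coincide, and there is a bijection between the separator domains aligning the coverages and
(when nonempty) the frequency statistics of the partitioned sub-populations. -/
def FullyRedundant {n : ℕ} {D : Fin n → Type} [∀ i, DecidableEq (D i)] {R : Type}
    (a : R → (i : Fin n) → D i) (T : Multiset R)
    (s1 s2 : (i : Fin n) → Option (D i)) (X : Fin n) (Y : R → Bool)
    (s1' s2' : (i : Fin n) → Option (D i)) (X' : Fin n) (Y' : R → Bool) : Prop :=
  cov a T s1 = cov a T s1' ∧ cov a T s2 = cov a T s2' ∧
  freq a T Y s1 = freq a T Y' s1' ∧ freq a T Y s2 = freq a T Y' s2' ∧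
  ∃ f : D X ≃ D X', ∀ v : D X,
    cov a T (Function.update s1 X (some v)) = cov a T (Function.update s1' X' (some (f v))) ∧
    cov a T (Function.update s2 X (some v)) = cov a T (Function.update s2' X' (some (f v))) ∧
    (cov a T (Function.update s1 X (some v)) ≠ 0 →
      freq a T Y (Function.update s1 X (some v))
        = freq a T Y' (Function.update s1' X' (some (f v)))) ∧
    (cov a T (Function.update s2 X (some v)) ≠ 0 →
      freq a T Y (Function.update s2 X (some v))
        = freq a T Y' (Function.update s2' X' (some (f v))))

theorem freq_congr_aux {n : ℕ} {D : Fin n → Type} [∀ i, DecidableEq (D i)] {R : Type}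
    (a : R → (i : Fin n) → D i) (T : Multiset R) (Y : R → Bool)
    (s s' : (i : Fin n) → Option (D i)) (h : cov a T s = cov a T s') :
    freq a T Y s = freq a T Y s' := by
  unfold freq; rw [h]

/-- **Extension by separator and statistic equivalence (Proposition 4.4, core case).**
If `p = (s1, s2, X, Y)` is a Simpson's paradox with differential attribute `j`,
`p' = (s1', s2', X', Y')` is a Simpson's paradox fully redundant to `p`, and `X'` is a valid
separator attribute for `(s1, s2)` (i.e. `X' ≠ j` and `s1 X' = none = s2 X'`), then
`(s1, s2, X', Y')` is a Simpson's paradox and is fully redundant to `p`. -/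
theorem extension_by_separator_statistic_equivalence
    {n : ℕ} {D : Fin n → Type} [∀ i, Fintype (D i)] [∀ i, Nonempty (D i)]
    [∀ i, DecidableEq (D i)] {R : Type}
    (a : R → (i : Fin n) → D i) (T : Multiset R)
    (s1 s2 s1' s2' : (i : Fin n) → Option (D i)) (j j' X X' : Fin n) (Y Y' : R → Bool)
    (hp : IsSimpson a T s1 s2 j X Y)
    (hp' : IsSimpson a T s1' s2' j' X' Y')
    (hred : FullyRedundant a T s1 s2 X Y s1' s2' X' Y')
    (hX'j : X' ≠ j) (hs1X' : s1 X' = none) (hs2X' : s2 X' = none) :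
    IsSimpson a T s1 s2 j X' Y' ∧ FullyRedundant a T s1 s2 X Y s1 s2 X' Y' := by
  obtain ⟨hsib, hXj, hs1X, hc1, hc2, -, -, -⟩ := hp
  obtain ⟨hsib', hXj', hs1X'', -, -, hle, hall, hstr⟩ := hp'
  obtain ⟨e1, e2, f1, f2, f, hf⟩ := hred
  have hs2X'' : s2' X' = none := by rw [← hsib'.2 X' hXj']; exact hs1X''
  have c1 : ∀ v, cov a T (Function.update s1' X' (some v)) =
      cov a T (Function.update s1 X' (some v)) := fun v => by
    rw [cov_update_aux a T s1' X' hs1X'', cov_update_aux a T s1 X' hs1X', e1]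
  have c2 : ∀ v, cov a T (Function.update s2' X' (some v)) =
      cov a T (Function.update s2 X' (some v)) := fun v => by
    rw [cov_update_aux a T s2' X' hs2X'', cov_update_aux a T s2 X' hs2X', e2]
  have g1 := fun v => freq_congr_aux a T Y' _ _ (c1 v)
  have g2 := fun v => freq_congr_aux a T Y' _ _ (c2 v)
  have k1 := freq_congr_aux a T Y' _ _ e1.symm
  have k2 := freq_congr_aux a T Y' _ _ e2.symm
  simp only [c1, c2, g1, g2, k1, k2] at hle hall hstr f1 f2 hf
  exact ⟨⟨hsib, hX'j, hs1X', hc1, hc2, hle, hall, hstr⟩, rfl, rfl, f1, f2, f, hf⟩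
end

section
/- Common descendant of coverage-identical populations (used in the proof of Property 3.10): Let s1, s2 be populations with cov(s1) = cov(s2) ≠ 0. Then: (a) for every i : Fin n, if s1 i = some v and s2 i = some v', then v = v'; and (b) the population s'' defined by s'' i = s1 i when s1 i ≠ none and s'' i = s2 i otherwise satisfies s1 ⊑ s'', s2 ⊑ s'', and cov(s'') = cov(s1). -/
/-- `s ⊑ s'`: `s` is an ancestor-or-equal of `s'` (wherever `s` is specified, `s'` agrees). -/
def Below {n : ℕ} {D : Fin n → Type}
    (s s' : (i : Fin n) → Option (D i)) : Prop :=
  ∀ i, s i = none ∨ s i = s' i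

/-- **Common descendant of coverage-identical populations (used in Property 3.10).**
If `cov s1 = cov s2 ≠ 0` then (a) `s1` and `s2` agree wherever both are specified, and
(b) the population taking `s1`'s value where specified and `s2`'s value elsewhere is a
common descendant of `s1` and `s2` with the same coverage. -/
theorem common_descendant_of_coverage_identical
    {n : ℕ} {D : Fin n → Type} [∀ i, Fintype (D i)] [∀ i, Nonempty (D i)]
    [∀ i, DecidableEq (D i)] {R : Type}
    (a : R → (i : Fin n) → D i) (T : Multiset R)
    (s1 s2 : (i : Fin n) → Option (D i))
    (hcov : cov a T s1 = cov a T s2) (hne : cov a T s1 ≠ 0) :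
    (∀ (i : Fin n) (v v' : D i), s1 i = some v → s2 i = some v' → v = v') ∧
    (Below s1 (fun i => if s1 i = none then s2 i else s1 i) ∧
      Below s2 (fun i => if s1 i = none then s2 i else s1 i) ∧
      cov a T (fun i => if s1 i = none then s2 i else s1 i) = cov a T s1) := by
  have hmem : ∀ t ∈ T, ((∀ i, s1 i = none ∨ s1 i = some (a t i)) ↔
      (∀ i, s2 i = none ∨ s2 i = some (a t i))) := by
    intro t ht
    have h : t ∈ cov a T s1 ↔ t ∈ cov a T s2 := by rw [hcov]
    simpa [cov, Multiset.mem_filter, ht] using h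
  obtain ⟨t, ht⟩ := Multiset.exists_mem_of_ne_zero hne
  have ht1 := ht
  rw [hcov] at ht
  have h1 := (Multiset.mem_filter.1 ht1).2
  have h2 := (Multiset.mem_filter.1 ht).2
  have hag : ∀ (i : Fin n) (v v' : D i), s1 i = some v → s2 i = some v' → v = v' := by
    intro i v v' e1 e2
    have p1 := h1 i
    have p2 := h2 i
    rw [e1] at p1
    rw [e2] at p2
    simp at p1 p2
    rw [p1, p2]
  refine ⟨hag, ?_, ?_, ?_⟩
  · intro i
    by_cases h : s1 i = none <;> simp [h]
  · intro i
    rcases e1 : s1 i with _ | v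
    · simp [e1]
    · rcases e2 : s2 i with _ | v'
      · simp
      · right
        simp [e1, hag i v v' e1 e2]
  · unfold cov
    apply Multiset.filter_congr
    intro t htT
    constructor
    · intro h i
      have hi := h i
      by_cases e : s1 i = none
      · exact Or.inl e
      · simpa [e] using hi
    · intro h i
      have h' := (hmem t htT).1 h i
      have hi := h i
      by_cases e : s1 i = none
      · simpa [e] using h'
      · simpa [e] using hi
end

section
/- Unique upper bound of a coverage group (Property 3.10, uniqueness part): Fix a population s with cov(s) ≠ 0 and let E = {s' : cov(s') = cov(s)} be its coverage group. Define s_u by s_u i = some v if there exists s' ∈ E with s' i = some v, and s_u i = none otherwise. Then s_u is well defined (for each i the value v is unique when it exists), s_u ∈ E, every s' ∈ E satisfies s' ⊑ s_u, and s_u is the unique element of E with this property; equivalently, s_u is the unique maximal element of E under ⊑. -/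
/-- **Unique upper bound of a coverage group (Property 3.10, uniqueness part).**
Fix `s` with `cov s ≠ 0` and let `E = {s' | cov s' = cov s}`. Then: (well-definedness) for
each attribute, the specified value taken by members of `E` is unique when it exists;
any population `su` satisfying the defining characterization (`su i = some v` iff some
member of `E` has value `some v` at `i`) lies in `E` and is `⊑`-above every member of `E`;
and there is exactly one member of `E` that is `⊑`-above every member of `E` (the unique
maximal element of `E` under `⊑`). -/
theorem unique_upper_bound_of_coverage_group
    {n : ℕ} {D : Fin n → Type} [∀ i, Fintype (D i)] [∀ i, Nonempty (D i)]
    [∀ i, DecidableEq (D i)] {R : Type}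
    (a : R → (i : Fin n) → D i) (T : Multiset R)
    (s : (i : Fin n) → Option (D i)) (hne : cov a T s ≠ 0) :
    (∀ (i : Fin n) (v v' : D i) (s' s'' : (i : Fin n) → Option (D i)),
      cov a T s' = cov a T s → cov a T s'' = cov a T s →
      s' i = some v → s'' i = some v' → v = v') ∧
    (∀ su : (i : Fin n) → Option (D i),
      (∀ (i : Fin n) (v : D i), su i = some v ↔
        ∃ s' : (i : Fin n) → Option (D i), cov a T s' = cov a T s ∧ s' i = some v) →
      cov a T su = cov a T s ∧
        ∀ s' : (i : Fin n) → Option (D i), cov a T s' = cov a T s → Below s' su) ∧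
    (∃! su : (i : Fin n) → Option (D i), cov a T su = cov a T s ∧
      ∀ s' : (i : Fin n) → Option (D i), cov a T s' = cov a T s → Below s' su) := by
  classical
  have key : ∀ s' : (i : Fin n) → Option (D i), cov a T s' = cov a T s → ∀ t ∈ T,
      ((∀ i, s' i = none ∨ s' i = some (a t i)) ↔ (∀ i, s i = none ∨ s i = some (a t i))) := by
    intro s' h t ht
    have h1 : t ∈ cov a T s' ↔ t ∈ cov a T s := by rw [h]
    simpa only [cov, Multiset.mem_filter, ht, true_and] using h1
  obtain ⟨t0, ht0⟩ := Multiset.exists_mem_of_ne_zero hne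
  rw [cov, Multiset.mem_filter] at ht0
  obtain ⟨hT, hm⟩ := ht0
  have val : ∀ s' : (i : Fin n) → Option (D i), cov a T s' = cov a T s → ∀ i v,
      s' i = some v → v = a t0 i := by
    intro s' h i v hv
    have h1 := (key s' h t0 hT).2 hm i
    rw [hv] at h1
    simpa using h1
  have part2 : ∀ su : (i : Fin n) → Option (D i),
      (∀ (i : Fin n) (v : D i), su i = some v ↔
        ∃ s' : (i : Fin n) → Option (D i), cov a T s' = cov a T s ∧ s' i = some v) →
      cov a T su = cov a T s ∧
        ∀ s' : (i : Fin n) → Option (D i), cov a T s' = cov a T s → Below s' su := by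
    intro su hsu
    refine ⟨?_, ?_⟩
    · unfold cov
      refine Multiset.filter_congr fun t ht => ⟨fun h i => ?_, fun h i => ?_⟩
      · rcases hs : s i with _ | v
        · exact Or.inl rfl
        · have h1 := h i
          rw [(hsu i v).2 ⟨s, rfl, hs⟩] at h1
          exact h1
      · rcases hs : su i with _ | v
        · exact Or.inl rfl
        · obtain ⟨s', hs', hv⟩ := (hsu i v).1 hs
          have h1 := (key s' hs' t ht).2 h i
          rw [hv] at h1
          exact h1
    · intro s' hs' i
      rcases hs : s' i with _ | v
      · exact Or.inl rfl
      · exact Or.inr ((hsu i v).2 ⟨s', hs', hs⟩).symm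
  refine ⟨?_, part2, ?_⟩
  · intro i v v' s' s'' h' h'' hv hv'
    rw [val s' h' i v hv, val s'' h'' i v' hv']
  · refine ⟨fun i => if ∃ s' : (i : Fin n) → Option (D i),
      cov a T s' = cov a T s ∧ s' i = some (a t0 i) then some (a t0 i) else none,
      part2 _ ?_, ?_⟩
    · intro i v
      constructor
      · intro h
        split_ifs at h with hc
        rw [← h]
        exact hc
      · rintro ⟨s', hs', hv⟩
        have e := val s' hs' i v hv
        subst e
        exact if_pos ⟨s', hs', hv⟩
    · rintro y ⟨hy, hy2⟩
      have hp := part2 (fun i => if ∃ s' : (i : Fin n) → Option (D i),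
        cov a T s' = cov a T s ∧ s' i = some (a t0 i) then some (a t0 i) else none) (by
          intro i v
          constructor
          · intro h
            split_ifs at h with hc
            rw [← h]
            exact hc
          · rintro ⟨s', hs', hv⟩
            have e := val s' hs' i v hv
            subst e
            exact if_pos ⟨s', hs', hv⟩)
      funext i
      have h1 := hp.2 y hy i
      have h2 := hy2 _ hp.1 i
      rcases h1 with h1 | h1
      · rcases h2 with h2 | h2
        · rw [h1]; exact h2.symm
        · exact h2.symm
      · exact h1
end

section
/- Reconstruction from bounds (Property 3.11): Let E be a nonempty convex set of populations. Then for every population s: s ∈ E if and only if there exist a lower bound s_l of E and an upper bound s_u of E such that s_l ⊑ s and s ⊑ s_u. -/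
/-- `s` is a parent of `s'`: `s ⊑ s'`, `s ≠ s'`, and they differ in exactly one coordinate. -/
def Parent {n : ℕ} {D : Fin n → Type}
    (s s' : (i : Fin n) → Option (D i)) : Prop :=
  Below s s' ∧ s ≠ s' ∧ ∃! i : Fin n, s i ≠ s' i

/-- `s` and `s'` are joined by a finite chain of members of `E` in which each consecutive
pair is related by the parent relation (in one direction or the other). -/
def ConnectedIn {n : ℕ} {D : Fin n → Type} (E : Set ((i : Fin n) → Option (D i)))
    (s s' : (i : Fin n) → Option (D i)) : Prop :=
  Relation.ReflTransGen (fun x y => x ∈ E ∧ y ∈ E ∧ (Parent x y ∨ Parent y x)) s s'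

/-- A set of populations is convex: closed under intermediate populations, and any two
members are connected by a chain of parent/child steps inside the set. -/
def ConvexSet {n : ℕ} {D : Fin n → Type} (E : Set ((i : Fin n) → Option (D i))) : Prop :=
  (∀ s s' s'' : (i : Fin n) → Option (D i),
    s ∈ E → s' ∈ E → Below s s'' → Below s'' s' → s'' ∈ E) ∧
  (∀ s s' : (i : Fin n) → Option (D i), s ∈ E → s' ∈ E → ConnectedIn E s s')

/-- `s` is an upper bound of `E`: a member of `E` with no member strictly above it. -/
def IsUpperBd {n : ℕ} {D : Fin n → Type} (E : Set ((i : Fin n) → Option (D i)))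
    (s : (i : Fin n) → Option (D i)) : Prop :=
  s ∈ E ∧ ¬ ∃ s' ∈ E, Below s s' ∧ s ≠ s'

/-- `s` is a lower bound of `E`: a member of `E` with no member strictly below it. -/
def IsLowerBd {n : ℕ} {D : Fin n → Type} (E : Set ((i : Fin n) → Option (D i)))
    (s : (i : Fin n) → Option (D i)) : Prop :=
  s ∈ E ∧ ¬ ∃ s' ∈ E, Below s' s ∧ s' ≠ s

/-- **Reconstruction from bounds (Property 3.11).** For a nonempty convex set `E` of
populations, `s ∈ E` iff there are a lower bound `sl` and an upper bound `su` of `E` with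
`sl ⊑ s ⊑ su`. -/
theorem reconstruction_from_bounds
    {n : ℕ} {D : Fin n → Type} [∀ i, Fintype (D i)] [∀ i, Nonempty (D i)]
    [∀ i, DecidableEq (D i)]
    (E : Set ((i : Fin n) → Option (D i))) (hE : E.Nonempty) (hconv : ConvexSet E)
    (s : (i : Fin n) → Option (D i)) :
    s ∈ E ↔ ∃ sl su : (i : Fin n) → Option (D i),
      IsLowerBd E sl ∧ IsUpperBd E su ∧ Below sl s ∧ Below s su := by
  classical
  have htrans : ∀ a b c : (i : Fin n) → Option (D i), Below a b → Below b c → Below a c := by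
    intro a b c h1 h2 i
    rcases h1 i with h | h
    · exact Or.inl h
    · rcases h2 i with h' | h'
      · exact Or.inl (h.trans h')
      · exact Or.inr (h.trans h')
  have hanti : ∀ a b : (i : Fin n) → Option (D i), Below a b → Below b a → a = b := by
    intro a b h1 h2
    funext i
    rcases h1 i with h | h
    · rcases h2 i with h' | h'
      · rw [h, h']
      · exact h'.symm
    · exact h
  letI : PartialOrder ((i : Fin n) → Option (D i)) :=
    { le := Below
      le_refl := fun _ _ => Or.inr rfl
      le_trans := htrans
      le_antisymm := hanti }
  constructor
  · intro hs
    obtain ⟨sl, hl, hlm⟩ := (Set.toFinite E).exists_le_minimal hs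
    obtain ⟨su, hu, hum⟩ := (Set.toFinite E).exists_le_maximal hs
    refine ⟨sl, su, ⟨hlm.1, ?_⟩, ⟨hum.1, ?_⟩, hl, hu⟩
    · rintro ⟨t, ht, hb, hne⟩
      exact hne (hanti _ _ hb (hlm.2 ht hb))
    · rintro ⟨t, ht, hb, hne⟩
      exact hne (hanti _ _ hb (hum.2 ht hb))
  · rintro ⟨sl, su, hl, hu, h1, h2⟩
    exact hconv.1 sl su s hl.1 hu.1 h1 h2
end

section
/- Impossibility of coverage identicality (Appendix Proposition): Suppose each domain D i has at least two elements, and suppose the records of T realize the full Cartesian product of the domains, i.e., for every x : (i : Fin n) → D i there exists t in T with a t = x. Then distinct populations have distinct coverages: for all populations s ≠ s', cov(s) ≠ cov(s'). -/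
theorem below_of_match_imp {n : ℕ} {D : Fin n → Type} [∀ i, Nonempty (D i)]
    (htwo : ∀ i : Fin n, ∃ v v' : D i, v ≠ v')
    (s s' : (i : Fin n) → Option (D i))
    (h : ∀ x : (i : Fin n) → D i, (∀ i, s i = none ∨ s i = some (x i)) →
      ∀ i, s' i = none ∨ s' i = some (x i)) (i : Fin n) :
    s' i = none ∨ s' i = s i := by
  classical
  let x : (i : Fin n) → D i := fun j => (s j).getD (Classical.arbitrary (D j))
  have hx : ∀ j, s j = none ∨ s j = some (x j) := by
    intro j
    cases hj : s j <;> simp [x, hj]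
  cases hi : s i with
  | some e =>
    have h1 := h x hx i
    simpa [x, hi] using h1
  | none =>
    left
    have key : ∀ v, s' i = none ∨ s' i = some v := by
      intro v
      have h1 := h (Function.update x i v) (by
        intro j
        by_cases hji : j = i
        · subst hji
          exact Or.inl hi
        · rw [Function.update_of_ne hji]
          exact hx j) i
      simpa using h1
    obtain ⟨v, w, hvw⟩ := htwo i
    rcases key v with h1 | h1
    · exact h1
    · rcases key w with h2 | h2
      · exact h2
      · exact absurd (Option.some.inj (h1.symm.trans h2)) hvw

/-- **Impossibility of coverage identicality (Appendix Proposition).** If every domain has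
at least two elements and the records of `T` realize the full Cartesian product of the
domains, then distinct populations have distinct coverages. -/
theorem distinct_populations_distinct_coverages
    {n : ℕ} {D : Fin n → Type} [∀ i, Fintype (D i)] [∀ i, Nonempty (D i)]
    [∀ i, DecidableEq (D i)] {R : Type}
    (a : R → (i : Fin n) → D i) (T : Multiset R)
    (htwo : ∀ i : Fin n, ∃ v v' : D i, v ≠ v')
    (hfull : ∀ x : (i : Fin n) → D i, ∃ t ∈ T, a t = x)
    (s s' : (i : Fin n) → Option (D i)) (hne : s ≠ s') :
    cov a T s ≠ cov a T s' := by
  intro hc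
  have hm : ∀ x : (i : Fin n) → D i, (∀ i, s i = none ∨ s i = some (x i)) ↔
      ∀ i, s' i = none ∨ s' i = some (x i) := by
    intro x
    obtain ⟨t, ht, rfl⟩ := hfull x
    have h1 : t ∈ cov a T s ↔ t ∈ cov a T s' := by rw [hc]
    simpa only [cov, Multiset.mem_filter, ht, true_and] using h1
  apply hne
  funext i
  have h1 := below_of_match_imp htwo s s' (fun x => (hm x).1) i
  have h2 := below_of_match_imp htwo s' s (fun x => (hm x).2) i
  rcases h1 with h1 | h1
  · rcases h2 with h2 | h2
    · rw [h1, h2]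
    · exact h2
  · exact h1.symm
end
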